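/- Let a₁, a₂ > 0 with a₁ ≠ a₂, let k ≥ 0 be an integer, and ω ∈ ℝ. Then the function w ↦ −e^{−iωw}/((w − ia₁)^{k+1}(w − ia₂)^{k+1}) is integrable on ℝ and ∫_ℝ −e^{−iωw} ((w − ia₁)^{k+1}(w − ia₂)^{k+1})^{−1} dw = (2π/((a₁−a₂)^{2k+1} k!)) ∑_{n=0}^{k} ((2k−n)!/(n!(k−n)!)) (a₁−a₂)^n ω^n [g(ω,a₂) − (−1)^n g(ω,a₁)], where g(ω,a) := e^{aω} · 1_{(−∞,0)}(ω). -/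

import Mathlib

open MeasureTheory

/-- The indicator-exponential function `g(ω,a) = e^{aω} 1_{(−∞,0)}(ω)`. -/
noncomputable def gfun (ω a : ℝ) : ℝ :=
  Real.exp (a * ω) * Set.indicator (Set.Iio (0 : ℝ)) (fun _ => (1 : ℝ)) ω


noncomputable def TT (A b : ℂ) (p : ℕ) (q : ℕ) : ℂ :=
  ∑ m ∈ Finset.range q, ((p + m).choose m : ℂ) * (A + b) ^ (q - 1 - m) * A ^ (p + 1) * b ^ m

lemma TT_zero (A b : ℂ) (p : ℕ) : TT A b p 0 = 0 := by simp [TT]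

lemma TT_succ (A b : ℂ) (p q : ℕ) :
    TT A b p (q + 1) = (A + b) * TT A b p q + ((p + q).choose q : ℂ) * A ^ (p + 1) * b ^ q := by
  unfold TT
  rw [Finset.sum_range_succ, Finset.mul_sum]
  congr 1
  · apply Finset.sum_congr rfl
    intro m hm
    rw [Finset.mem_range] at hm
    have : q + 1 - 1 - m = (q - 1 - m) + 1 := by omega
    rw [this, pow_succ]; ring
  · simp

lemma TT_rec (A b : ℂ) (p q : ℕ) :
    TT A b (p + 1) (q + 1) = A * TT A b p (q + 1) + b * TT A b (p + 1) q := by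
  induction q with
  | zero => simp [TT]; ring
  | succ q ih =>
    rw [TT_succ A b (p+1) (q+1), ih, TT_succ A b p (q+1)]
    have h : ((p + 1 + (q + 1)).choose (q + 1) : ℂ)
        = ((p + (q + 1)).choose (q+1) : ℂ) + ((p + 1 + q).choose q : ℂ) := by
      have : p + 1 + (q + 1) = (p + 1 + q) + 1 := by ring
      rw [this, Nat.choose_succ_succ]
      have : p + (q + 1) = p + 1 + q := by ring
      rw [this]; push_cast; ring
    rw [h]
    have := ih
    rw [TT_succ A b (p+1) q] at this
    linear_combination b * this

lemma TT_b0 (A b : ℂ) (q : ℕ) : TT A b 0 (q + 1) + TT b A q 1 = (A + b) ^ (q + 1) := by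
  induction q with
  | zero => simp [TT]
  | succ q ih =>
    rw [TT_succ]
    simp [TT] at ih ⊢
    rw [pow_succ (A+b) (q+1), ← ih]; ring

lemma TT_add (A b : ℂ) (p q : ℕ) :
    TT A b p (q + 1) + TT b A q (p + 1) = (A + b) ^ (p + q + 1) := by
  induction p generalizing q with
  | zero => simpa using TT_b0 A b q
  | succ p ihp =>
    induction q with
    | zero =>
      have := TT_b0 b A (p+1)
      rw [add_comm b A] at this
      rw [← this]; ring
    | succ q ihq =>
      rw [TT_rec A b p (q+1), TT_rec b A q (p+1)]
      have := ihp (q+1)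
      rw [pow_succ]
      have e : p + 1 + (q + 1) = p + (q+1) + 1 := by ring
      rw [e]
      have e : p + 1 + q + 1 = p + (q+1) + 1 := by ring
      rw [e] at ihq
      linear_combination A * this + b * ihq

/-- partial fractions -/
lemma pf (A B : ℂ) (hA : A ≠ 0) (hB : B ≠ 0) (k : ℕ) :
    ∑ n ∈ Finset.range (k + 1), ((2 * k - n).choose k : ℂ) * (A - B) ^ n *
      ((-1) ^ n / B ^ (n + 1) - 1 / A ^ (n + 1)) = (-1) ^ k * (A - B) ^ (2 * k + 1) / (A * B) ^ (k + 1) := by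
  have h := TT_add A (-B) k k
  rw [eq_div_iff (by positivity), ← two_mul, ← sub_eq_add_neg] at *
  rw [← h]
  unfold TT
  rw [← Finset.sum_range_reflect, ← Finset.sum_add_distrib, Finset.sum_mul, Finset.mul_sum]
  apply Finset.sum_congr rfl
  intro m hm
  rw [Finset.mem_range] at hm
  obtain ⟨j, rfl⟩ : ∃ j, k = m + j := ⟨k - m, by omega⟩
  have e1 : m + j + 1 - 1 - m = j := by omega
  have e2 : 2 * (m + j) - j = (m + j) + m := by omega
  rw [e1, e2, ← Nat.choose_symm_add]
  have e3 : (-1 : ℂ) ^ (m + j) * (-B) ^ m = (-1)^j * B ^ m := by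
    rw [neg_pow B, pow_add]
    have : ((-1 : ℂ) ^ m) * (-1) ^ m = 1 := by rw [← mul_pow]; simp
    linear_combination this * (-1)^j * B^m
  have e4 : (-1 : ℂ) ^ (m + j) * (-B) ^ (m + j + 1) = - B ^ (m + j + 1) := by
    rw [neg_pow B, pow_succ (-1 : ℂ) (m+j)]
    have : ((-1 : ℂ) ^ (m+j)) * (-1) ^ (m+j) = 1 := by rw [← mul_pow]; simp
    linear_combination - this * B^(m+j+1)
  have e5 : ((-1) ^ j / B ^ (j + 1) - 1 / A ^ (j + 1)) * (A * B) ^ (m + j + 1)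
     = (-1) ^ j * B ^ m * A ^ (m + j + 1) - A ^ m * B ^ (m + j + 1) := by
    field_simp
    ring
  have e6 : -B + A = A - B := by ring
  rw [mul_assoc, e5, e6]
  linear_combination - ((m + j + m).choose (m+j) : ℂ) * (A - B)^j * (A ^ (m+j+1) * e3 + A ^ m * e4)

lemma norm_pe (A : ℂ) (n : ℕ) (t : ℝ) (ht : 0 ≤ t) :
    ‖(t : ℂ) ^ n * Complex.exp (-A * t)‖ = t ^ (n : ℝ) * Real.exp (-A.re * t) := by
  rw [norm_mul, norm_pow, Complex.norm_exp, Complex.norm_of_nonneg ht, Real.rpow_natCast]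
  simp

lemma int_pe (A : ℂ) (hA : 0 < A.re) (n : ℕ) :
    IntegrableOn (fun t : ℝ => (t : ℂ) ^ n * Complex.exp (-A * t)) (Set.Ioi 0) := by
  have h := integrableOn_rpow_mul_exp_neg_mul_rpow (p := 1) (s := n) (b := A.re)
    (by have : (0:ℝ) ≤ n := by positivity
        linarith) one_pos hA
  refine Integrable.mono' h (by fun_prop) ?_
  filter_upwards [ae_restrict_mem measurableSet_Ioi] with t ht
  rw [norm_pe A n t (le_of_lt ht), Real.rpow_one]

lemma integral_pe (A : ℂ) (hA : 0 < A.re) (n : ℕ) :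
    ∫ t in Set.Ioi (0:ℝ), (t : ℂ) ^ n * Complex.exp (-A * t) = n.factorial / A ^ (n + 1) := by
  have hA0 : A ≠ 0 := by rintro rfl; simp at hA
  induction n with
  | zero =>
    have := integral_exp_mul_complex_Ioi (a := -A) (by simpa using hA) 0
    simp at this ⊢
    rw [this]
  | succ n ih =>
    have hd : ∀ x ∈ Set.Ici (0:ℝ), HasDerivAt (fun t : ℝ => (t : ℂ) ^ (n+1) * Complex.exp (-A * t))
        ((n+1) * ((x : ℂ) ^ n * Complex.exp (-A * x)) - A * ((x : ℂ) ^ (n+1) * Complex.exp (-A * x))) x := by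
      intro x _
      have h1 : HasDerivAt (fun z : ℂ => z ^ (n+1) * Complex.exp (-A * z))
        ((n+1) * ((x : ℂ) ^ n * Complex.exp (-A * x)) - A * ((x : ℂ) ^ (n+1) * Complex.exp (-A * x))) (x : ℂ) := by
        have := (hasDerivAt_pow (n+1) (x : ℂ)).mul (((hasDerivAt_id (x : ℂ)).const_mul (-A)).cexp)
        refine this.congr_deriv ?_
        simp; ring
      exact h1.comp_ofReal
    have i1 := (int_pe A hA n).const_mul ((n:ℂ)+1)
    have i2 := (int_pe A hA (n+1)).const_mul A
    have ht : Filter.Tendsto (fun t : ℝ => (t : ℂ) ^ (n+1) * Complex.exp (-A * t)) Filter.atTop (nhds 0) := by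
      rw [tendsto_zero_iff_norm_tendsto_zero]
      refine (tendsto_rpow_mul_exp_neg_mul_atTop_nhds_zero ((n+1 : ℕ):ℝ) A.re hA).congr' ?_
      filter_upwards [Filter.eventually_ge_atTop 0] with t ht
      rw [norm_pe A (n+1) t ht]
    have key := integral_Ioi_of_hasDerivAt_of_tendsto' hd (i1.sub i2) ht
    rw [integral_sub i1 i2, integral_const_mul, integral_const_mul, ih] at key
    simp at key
    rw [Nat.factorial_succ, eq_div_iff (by positivity)]
    push_cast
    have h2 : (n.factorial : ℂ) / A ^ (n+1) * A ^ (n+1) = n.factorial := by field_simp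
    rw [pow_succ A (n+1)]
    simp only [neg_mul] 
    linear_combination (-A ^ (n+1)) * key + (n+1) * h2

lemma gterm (n : ℕ) (a w : ℝ) :
    (fun v : ℝ => Complex.exp (Complex.I * w * v) * ((v ^ n * gfun v a : ℝ) : ℂ)) =
     fun v => (Set.Ioi (0:ℝ)).indicator (fun t : ℝ => (-1) ^ n * ((t : ℂ) ^ n * Complex.exp (-(a + Complex.I * w) * t))) (-v) := by
  ext v
  unfold gfun
  by_cases hv : v < 0
  · have : -v ∈ Set.Ioi (0:ℝ) := by simpa using hv
    rw [Set.indicator_of_mem this, Set.indicator_of_mem (by exact hv)]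
    push_cast
    rw [neg_pow (v : ℂ), mul_one, mul_left_comm, ← Complex.exp_add, ← mul_assoc, ← mul_assoc, ← mul_pow]
    simp
    left; congr 1; ring
  · have : -v ∉ Set.Ioi (0:ℝ) := by simpa using hv
    rw [Set.indicator_of_notMem this, Set.indicator_of_notMem (by exact hv)]
    simp

lemma gterm_int (n : ℕ) (a w : ℝ) (ha : 0 < a) :
    Integrable (fun v : ℝ => Complex.exp (Complex.I * w * v) * ((v ^ n * gfun v a : ℝ) : ℂ)) := by
  rw [gterm]
  apply Integrable.comp_neg (f := (Set.Ioi (0:ℝ)).indicator (fun t : ℝ => (-1) ^ n * ((t : ℂ) ^ n * Complex.exp (-(a + Complex.I * w) * t))))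
  rw [integrable_indicator_iff measurableSet_Ioi]
  exact (int_pe _ (by simpa using ha) n).const_mul _

lemma gterm_integral (n : ℕ) (a w : ℝ) (ha : 0 < a) :
    ∫ v : ℝ, Complex.exp (Complex.I * w * v) * ((v ^ n * gfun v a : ℝ) : ℂ) =
      (-1) ^ n * (n.factorial / (a + Complex.I * w) ^ (n + 1)) := by
  rw [gterm, integral_neg_eq_self (fun v => (Set.Ioi (0:ℝ)).indicator (fun t : ℝ => (-1) ^ n * ((t : ℂ) ^ n * Complex.exp (-(a + Complex.I * w) * t))) v),
    integral_indicator measurableSet_Ioi, integral_const_mul, integral_pe _ (by simpa using ha)]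

noncomputable def RR (a₁ a₂ : ℝ) (k : ℕ) (ω : ℝ) : ℝ :=
  (2 * Real.pi / ((a₁ - a₂) ^ (2 * k + 1) * (Nat.factorial k)) *
        ∑ n ∈ Finset.range (k + 1),
          ((Nat.factorial (2 * k - n) : ℝ) / (Nat.factorial n * Nat.factorial (k - n))) *
            (a₁ - a₂) ^ n * ω ^ n * (gfun ω a₂ - (-1) ^ n * gfun ω a₁))

lemma RR_cont (a₁ a₂ : ℝ) (k : ℕ) : Continuous (RR a₁ a₂ k) := by
  unfold RR
  refine continuous_const.mul (continuous_finsetSum _ fun n _ => ?_)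
  have : (fun ω : ℝ => ((Nat.factorial (2 * k - n) : ℝ) / (Nat.factorial n * Nat.factorial (k - n))) *
            (a₁ - a₂) ^ n * ω ^ n * (gfun ω a₂ - (-1) ^ n * gfun ω a₁)) =
    fun ω => ((Nat.factorial (2 * k - n) : ℝ) / (Nat.factorial n * Nat.factorial (k - n))) *
            (a₁ - a₂) ^ n * ((min ω 0) ^ n * (Real.exp (a₂ * min ω 0) - (-1) ^ n * Real.exp (a₁ * min ω 0))) := by
    ext ω
    rw [mul_assoc]
    congr 1
    unfold gfun
    by_cases h : ω < 0
    · rw [Set.indicator_of_mem (by exact h), min_eq_left h.le]; simp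
    · rw [Set.indicator_of_notMem (by exact h), min_eq_right (not_lt.1 h)]
      rcases n with _ | n <;> simp
  rw [this]
  fun_prop

lemma RR_expand (a₁ a₂ : ℝ) (k : ℕ) (w v : ℝ) :
   Complex.exp (Complex.I * w * v) * (RR a₁ a₂ k v : ℂ) =
   (2 * Real.pi / ((a₁ - a₂ : ℂ) ^ (2 * k + 1) * (Nat.factorial k))) *
        ∑ n ∈ Finset.range (k + 1),
          (((Nat.factorial (2 * k - n) : ℂ) / (Nat.factorial n * Nat.factorial (k - n))) *
            (a₁ - a₂) ^ n) * (Complex.exp (Complex.I * w * v) * ((v ^ n * gfun v a₂ : ℝ) : ℂ)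
             - (-1) ^ n * (Complex.exp (Complex.I * w * v) * ((v ^ n * gfun v a₁ : ℝ) : ℂ))) := by
  unfold RR
  push_cast
  rw [mul_left_comm, Finset.mul_sum]
  congr 1
  apply Finset.sum_congr rfl
  intro n _
  ring

lemma RR_int (a₁ a₂ : ℝ) (h1 : 0 < a₁) (h2 : 0 < a₂) (k : ℕ) (w : ℝ) :
    Integrable (fun v : ℝ => Complex.exp (Complex.I * w * v) * (RR a₁ a₂ k v : ℂ)) := by
  simp_rw [RR_expand]
  refine Integrable.const_mul (integrable_finsetSum _ fun n _ => Integrable.const_mul ?_ _) _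
  exact (gterm_int n a₂ w h2).sub ((gterm_int n a₁ w h1).const_mul _)

lemma RR_integral (a₁ a₂ : ℝ) (h1 : 0 < a₁) (h2 : 0 < a₂) (hne : a₁ ≠ a₂) (k : ℕ) (w : ℝ) :
    ∫ v : ℝ, Complex.exp (Complex.I * w * v) * (RR a₁ a₂ k v : ℂ) = 
     2 * Real.pi * (-1 / (((w : ℂ) - Complex.I * a₁) ^ (k + 1) * ((w : ℂ) - Complex.I * a₂) ^ (k + 1))) := by
  simp_rw [RR_expand]
  rw [integral_const_mul, integral_finsetSum]
  swap
  · intro n _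
    exact ((gterm_int n a₂ w h2).sub ((gterm_int n a₁ w h1).const_mul _)).const_mul _
  have hA : (a₁ + Complex.I * w) ≠ 0 := by
    intro h; have := congrArg Complex.re h; simp at this; linarith
  have hB : (a₂ + Complex.I * w) ≠ 0 := by
    intro h; have := congrArg Complex.re h; simp at this; linarith
  have hD : (a₁ - a₂ : ℂ) ≠ 0 := by
    rw [sub_ne_zero]; exact_mod_cast hne
  have P := pf _ _ hA hB k
  have e : ((a₁ : ℂ) + Complex.I * w) - (a₂ + Complex.I * w) = a₁ - a₂ := by ring
  rw [e] at P
  have S : ∑ n ∈ Finset.range (k + 1), ∫ v : ℝ, (((Nat.factorial (2 * k - n) : ℂ) / (Nat.factorial n * Nat.factorial (k - n))) *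
            (a₁ - a₂) ^ n) * (Complex.exp (Complex.I * w * v) * ((v ^ n * gfun v a₂ : ℝ) : ℂ)
             - (-1) ^ n * (Complex.exp (Complex.I * w * v) * ((v ^ n * gfun v a₁ : ℝ) : ℂ))) =
      k.factorial * ((-1) ^ k * (a₁ - a₂ : ℂ) ^ (2 * k + 1) / ((a₁ + Complex.I * w) * (a₂ + Complex.I * w)) ^ (k + 1)) := by
    rw [← P, Finset.mul_sum]
    apply Finset.sum_congr rfl
    intro n hn
    rw [Finset.mem_range] at hn
    rw [integral_const_mul, integral_sub (gterm_int n a₂ w h2) ((gterm_int n a₁ w h1).const_mul _),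
      integral_const_mul, gterm_integral n a₂ w h2, gterm_integral n a₁ w h1]
    have c : ((2 * k - n).choose k : ℂ) = (2*k-n).factorial / (k.factorial * (k - n).factorial) := by
      rw [Nat.cast_choose ℂ (by omega)]
      congr 4; omega
    rw [c]
    have s : ((-1 : ℂ) ^ n) * (-1) ^ n = 1 := by rw [← mul_pow]; simp
    have f1 : (k.factorial : ℂ) ≠ 0 := by exact_mod_cast k.factorial_ne_zero
    have f2 : (n.factorial : ℂ) ≠ 0 := by exact_mod_cast n.factorial_ne_zero
    have f3 : ((k-n).factorial : ℂ) ≠ 0 := by exact_mod_cast (k-n).factorial_ne_zero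
    rw [← mul_assoc ((-1 : ℂ) ^ n) ((-1) ^ n), s]
    field_simp
  rw [S]
  have f1 : (k.factorial : ℂ) ≠ 0 := by exact_mod_cast k.factorial_ne_zero
  have q1 : (w : ℂ) - Complex.I * a₁ = -Complex.I * (a₁ + Complex.I * w) := by
    linear_combination (w : ℂ) * Complex.I_sq
  have q2 : (w : ℂ) - Complex.I * a₂ = -Complex.I * (a₂ + Complex.I * w) := by
    linear_combination (w : ℂ) * Complex.I_sq
  rw [← mul_pow, q1, q2]
  have q3 : -Complex.I * (a₁ + Complex.I * w) * (-Complex.I * (a₂ + Complex.I * w)) =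
     -1 * ((a₁ + Complex.I * w) * (a₂ + Complex.I * w)) := by
    linear_combination ((a₁ + Complex.I * w) * (a₂ + Complex.I * w)) * Complex.I_sq
  rw [q3, mul_pow (-1 : ℂ)]
  have s : ((-1 : ℂ) ^ k) * (-1) ^ k = 1 := by rw [← mul_pow]; simp
  have s0 : ((-1 : ℂ) ^ k) ≠ 0 := by simp
  have hP : ((a₁ + Complex.I * w) * (a₂ + Complex.I * w)) ^ (k+1) ≠ 0 := pow_ne_zero _ (mul_ne_zero hA hB)
  generalize ((a₁ + Complex.I * w) * (a₂ + Complex.I * w)) ^ (k+1) = Q at *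
  rw [pow_succ (-1 : ℂ) k]
  generalize (-1 : ℂ) ^ k = z at *
  have : -1 / (z * -1 * Q) = z / Q := by
    field_simp
    linear_combination - s
  rw [this]
  field_simp

lemma G_int (a₁ a₂ : ℝ) (h1 : 0 < a₁) (h2 : 0 < a₂) (k : ℕ) (ω : ℝ) :
    Integrable (fun w : ℝ =>
      -Complex.exp (-Complex.I * ω * w) /
        (((w : ℂ) - Complex.I * a₁) ^ (k + 1) * ((w : ℂ) - Complex.I * a₂) ^ (k + 1))) := by
  have hn : ∀ a : ℝ, 0 < a → ∀ w : ℝ, (w : ℂ) - Complex.I * a ≠ 0 := by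
    intro a ha w h; have := congrArg Complex.im h; simp at this; linarith
  have hb : ∀ a : ℝ, 0 < a → ∀ w : ℝ, a ≤ ‖(w : ℂ) - Complex.I * a‖ := by
    intro a ha w
    have := Complex.abs_im_le_norm ((w : ℂ) - Complex.I * a)
    simpa [abs_of_pos ha] using this
  have hs : ∀ a : ℝ, 0 < a → ∀ w : ℝ, ((min a 1) ^ 2) * (1 + w ^ 2) ≤ ‖(w : ℂ) - Complex.I * a‖ ^ 2 := by
    intro a ha w
    rw [← Complex.normSq_eq_norm_sq, Complex.normSq_apply]
    simp
    have m0 : 0 < min a 1 := by positivity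
    have m1 : min a 1 ≤ a := min_le_left _ _
    have m2 : min a 1 ≤ 1 := min_le_right _ _
    have : (min a 1)^2 ≤ a^2 := by gcongr
    have : (min a 1)^2 ≤ 1 := by nlinarith
    nlinarith [sq_nonneg w]
  have hc : ∀ w : ℝ, (min a₁ 1 * min a₂ 1) * (1 + w ^ 2) ≤ ‖(w : ℂ) - Complex.I * a₁‖ * ‖(w : ℂ) - Complex.I * a₂‖ := by
    intro w
    have m1 : 0 < min a₁ 1 := by positivity
    have m2 : 0 < min a₂ 1 := by positivity
    apply le_of_sq_le_sq _ (by positivity)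
    calc _ = (((min a₁ 1) ^ 2) * (1 + w ^ 2)) * (((min a₂ 1) ^ 2) * (1 + w ^ 2)) := by ring
      _ ≤ ‖(w : ℂ) - Complex.I * a₁‖ ^ 2 * ‖(w : ℂ) - Complex.I * a₂‖ ^ 2 :=
        mul_le_mul (hs a₁ h1 w) (hs a₂ h2 w) (by positivity) (by positivity)
      _ = _ := by ring
  have m1 : 0 < min a₁ 1 := by positivity
  have m2 : 0 < min a₂ 1 := by positivity
  refine Integrable.mono' (integrable_inv_one_add_sq.const_mul (((a₁ * a₂) ^ k * (min a₁ 1 * min a₂ 1))⁻¹)) ?_ ?_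
  · apply Continuous.aestronglyMeasurable
    refine Continuous.div (by fun_prop) (by fun_prop) fun w => ?_
    exact mul_ne_zero (pow_ne_zero _ (hn _ h1 w)) (pow_ne_zero _ (hn _ h2 w))
  · refine Filter.Eventually.of_forall fun w => ?_
    rw [norm_div, norm_neg, Complex.norm_exp, ← mul_pow, norm_pow, norm_mul, ← mul_inv]
    have : (-Complex.I * ω * w).re = 0 := by simp
    rw [this, Real.exp_zero, one_div]
    apply inv_anti₀ (by positivity)
    rw [pow_succ _ k, mul_assoc ((a₁ * a₂) ^ k)]
    refine mul_le_mul (pow_le_pow_left₀ (by positivity) ?_ k) (hc w) (by positivity) (by positivity)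
    have := hb a₁ h1 w
    have := hb a₂ h2 w
    exact mul_le_mul (hb a₁ h1 w) (hb a₂ h2 w) h2.le (norm_nonneg _)

open FourierTransform in
lemma main_int (a₁ a₂ : ℝ) (h1 : 0 < a₁) (h2 : 0 < a₂) (hne : a₁ ≠ a₂) (k : ℕ) (ω : ℝ) :
    (∫ w : ℝ, -Complex.exp (-Complex.I * ω * w) /
        (((w : ℂ) - Complex.I * a₁) ^ (k + 1) * ((w : ℂ) - Complex.I * a₂) ^ (k + 1))) = (RR a₁ a₂ k ω : ℂ) := by
  set G : ℝ → ℂ := fun w => -1 / (((w : ℂ) - Complex.I * a₁) ^ (k + 1) * ((w : ℂ) - Complex.I * a₂) ^ (k + 1)) with hG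
  set f : ℝ → ℂ := fun v => (RR a₁ a₂ k v : ℂ) with hf
  have fc : Continuous f := Complex.continuous_ofReal.comp (RR_cont a₁ a₂ k)
  have fi : Integrable f := by simpa using RR_int a₁ a₂ h1 h2 k 0
  have Gi : Integrable G := by simpa using G_int a₁ a₂ h1 h2 k 0
  have hinv : ∀ t : ℝ, 𝓕⁻ f t = 2 * Real.pi * G (2 * Real.pi * t) := by
    intro t
    rw [Real.fourierInv_eq', hG]
    have := RR_integral a₁ a₂ h1 h2 hne k (2 * Real.pi * t)
    simp only at this ⊢
    rw [← this]
    congr 1; ext v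
    rw [smul_eq_mul, hf]
    congr 2
    simp; ring
  have hft : 𝓕 f = fun t => 2 * Real.pi * G ((-2 * Real.pi) * t) := by
    ext t
    have := hinv (-t)
    rw [Real.fourierInv_eq_fourier_neg, neg_neg] at this
    rw [this]
    congr 2; ring
  have hfi : Integrable (𝓕 f) := by
    rw [hft]
    exact ((integrable_comp_mul_left_iff G (by simp [Real.pi_ne_zero])).2 Gi).const_mul _
  have key := congrFun (fc.fourier_fourierInv_eq fi hfi) ω
  rw [Real.fourier_eq'] at key
  change _ = f ω
  rw [← key]
  have := Measure.integral_comp_mul_left (fun w : ℝ => -Complex.exp (-Complex.I * ω * w) /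
        (((w : ℂ) - Complex.I * a₁) ^ (k + 1) * ((w : ℂ) - Complex.I * a₂) ^ (k + 1))) (2 * Real.pi)
  have e : ∀ v : ℝ, Complex.exp ((↑(-2 * Real.pi * inner ℝ v ω) * Complex.I)) • 𝓕⁻ f v = 
     (2 * Real.pi : ℂ) * (fun w : ℝ => -Complex.exp (-Complex.I * ω * w) /
        (((w : ℂ) - Complex.I * a₁) ^ (k + 1) * ((w : ℂ) - Complex.I * a₂) ^ (k + 1))) (2 * Real.pi * v) := by
    intro v
    rw [hinv v, hG, smul_eq_mul]
    have e2 : (↑(-2 * Real.pi * inner ℝ v ω) * Complex.I) = -Complex.I * ω * ((2 * Real.pi * v : ℝ) : ℂ) := by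
      simp; ring
    rw [e2]
    ring
  simp_rw [e]
  rw [integral_const_mul, this, abs_of_pos (by positivity)]
  simp only [Complex.real_smul]
  push_cast
  rw [← mul_assoc, mul_inv_cancel₀ (by simp [Real.pi_ne_zero]), one_mul]

/-- Second part of Lemma 3.4 of the paper: the Fourier transform of
`w ↦ −((w − ia₁)(w − ia₂))^{−(k+1)}`. -/
theorem stmt4 (a₁ a₂ : ℝ) (h1 : 0 < a₁) (h2 : 0 < a₂) (hne : a₁ ≠ a₂)
    (k : ℕ) (ω : ℝ) :
    Integrable (fun w : ℝ =>
      -Complex.exp (-Complex.I * ω * w) /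
        (((w : ℂ) - Complex.I * a₁) ^ (k + 1) * ((w : ℂ) - Complex.I * a₂) ^ (k + 1))) ∧
    (∫ w : ℝ, -Complex.exp (-Complex.I * ω * w) /
        (((w : ℂ) - Complex.I * a₁) ^ (k + 1) * ((w : ℂ) - Complex.I * a₂) ^ (k + 1))) =
      ((2 * Real.pi / ((a₁ - a₂) ^ (2 * k + 1) * (Nat.factorial k)) *
        ∑ n ∈ Finset.range (k + 1),
          ((Nat.factorial (2 * k - n) : ℝ) / (Nat.factorial n * Nat.factorial (k - n))) *
            (a₁ - a₂) ^ n * ω ^ n * (gfun ω a₂ - (-1) ^ n * gfun ω a₁) : ℝ) : ℂ) := by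
  exact ⟨G_int a₁ a₂ h1 h2 k ω, main_int a₁ a₂ h1 h2 hne k ω⟩
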